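/- arXiv:1807.00320 — 2 statements merged into one kernel-verified Lean document; each statement's English description precedes it below -/
import Mathlib

section
/- For every m-th order n-dimensional real tensor A and every a ∈ ℝ^n, the number of connected components of the solution set Sol(A,a) (with its subspace topology) does not exceed χ = d(2d-1)^{5n}, where d = max{2, m-1}. -/
open Finset MeasureTheory Pointwise

/-- For a tensor `A` of order `k+1` and dimension `n` (entries `A i j` = `a_{i, j 0, …, j (k-1)}`),
`tApply A x` is the vector `A x^{k}` with `i`-th component
`∑_{i_2,…,i_{k+1}} a_{i i_2 ⋯ i_{k+1}} x_{i_2} ⋯ x_{i_{k+1}}`. -/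
noncomputable def tApply {n k : ℕ} (A : Fin n → (Fin k → Fin n) → ℝ) (x : Fin n → ℝ) :
    Fin n → ℝ :=
  fun i => ∑ j : Fin k → Fin n, A i j * ∏ l : Fin k, x (j l)

/-- The solution set of the tensor complementarity problem `TCP(A,a)`. -/
def Sol {n k : ℕ} (A : Fin n → (Fin k → Fin n) → ℝ) (a : Fin n → ℝ) : Set (Fin n → ℝ) :=
  {x | (∀ i, 0 ≤ x i) ∧ (∀ i, 0 ≤ tApply A x i + a i) ∧ ∑ i, x i * (tApply A x i + a i) = 0}

/-- `A` is an R₀-tensor if `Sol(A,0) = {0}`. -/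
def IsR0 {n k : ℕ} (A : Fin n → (Fin k → Fin n) → ℝ) : Prop := Sol A 0 = {0}

/-- Frobenius norm of a tensor. -/
noncomputable def tNorm {n k : ℕ} (A : Fin n → (Fin k → Fin n) → ℝ) : ℝ :=
  Real.sqrt (∑ i, ∑ j, (A i j) ^ 2)

/-- Euclidean norm of a vector in ℝⁿ. -/
noncomputable def eNorm {n : ℕ} (x : Fin n → ℝ) : ℝ := Real.sqrt (∑ i, (x i) ^ 2)

/-- exponent vectors of total degree at most `T` -/
def expSet (σ : Type) [Fintype σ] [DecidableEq σ] (T : ℕ) : Finset (σ → ℕ) :=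
  (Fintype.piFinset fun _ => range (T + 1)).filter fun α => ∑ s, α s ≤ T

lemma mem_expSet {σ : Type} [Fintype σ] [DecidableEq σ] {T : ℕ} {α : σ → ℕ} :
    α ∈ expSet σ T ↔ ∑ s, α s ≤ T := by
  simp only [expSet, mem_filter, Fintype.mem_piFinset, mem_range, and_iff_right_iff_imp]
  intro h s
  have := Finset.single_le_sum (f := α) (fun _ _ => Nat.zero_le _) (mem_univ s)
  omega

lemma card_expSet_le {σ : Type} [Fintype σ] [DecidableEq σ] (T : ℕ) :
    (expSet σ T).card ≤ (T + 1) ^ Fintype.card σ := by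
  refine (card_filter_le _ _).trans ?_
  simp

lemma card_expSet_pos {σ : Type} [Fintype σ] [DecidableEq σ] (T : ℕ) :
    0 < (expSet σ T).card :=
  Finset.card_pos.2 ⟨0, by simp [mem_expSet]⟩

lemma card_expSet_mul {σ : Type} [Fintype σ] [DecidableEq σ] (e : ℕ) (he : 1 ≤ e) (T : ℕ) :
    (expSet σ (e * T)).card ≤ e ^ Fintype.card σ * (expSet σ T).card := by
  have : (expSet σ (e * T)).card ≤
      ((Fintype.piFinset fun _ : σ => range e) ×ˢ expSet σ T).card := by
    refine Finset.card_le_card_of_injOn (fun α => (fun s => α s % e, fun s => α s / e)) ?_ ?_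
    · intro α hα
      have hα := mem_expSet.1 (mem_coe.1 hα)
      simp only [coe_product, Set.mem_prod, mem_coe, Fintype.mem_piFinset, mem_range, mem_expSet]
      refine ⟨fun s => Nat.mod_lt _ he, ?_⟩
      refine le_of_mul_le_mul_left (a := e) ?_ he
      rw [Finset.mul_sum]
      exact (Finset.sum_le_sum fun s _ => Nat.mul_div_le _ _).trans hα
    · intro α _ β _ h
      simp only [Prod.mk.injEq] at h
      ext s
      rw [← Nat.mod_add_div (α s) e, ← Nat.mod_add_div (β s) e, congrFun h.1 s, congrFun h.2 s]
  refine this.trans ?_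
  simp [card_product]

lemma growth (N E r M : ℕ) (a : ℕ → ℕ) (hpos : 0 < a 0) (hpoly : ∀ T, a T ≤ (T + 1) ^ M)
    (h : ∀ T, N * a T ≤ E * a (T + r)) : N ≤ E := by
  by_contra hlt
  push Not at hlt
  have h1 : ∀ k, N ^ k ≤ E ^ k * a (k * r) := by
    intro k
    induction k with
    | zero => simpa using (show 1 ≤ a 0 from hpos)
    | succ k ih =>
      calc N ^ (k+1) = N * N ^ k := by ring
        _ ≤ N * (E ^ k * a (k * r)) := by gcongr
        _ = E ^ k * (N * a (k * r)) := by ring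
        _ ≤ E ^ k * (E * a (k * r + r)) := Nat.mul_le_mul_left _ (h _)
        _ = E ^ (k+1) * a ((k + 1) * r) := by rw [add_mul, one_mul]; ring
  have h2 : ∀ k, N ^ k ≤ E ^ k * (k * r + 1) ^ M := fun k =>
    (h1 k).trans (Nat.mul_le_mul_left _ (hpoly _))
  have hN : (0:ℝ) < N := by exact_mod_cast (Nat.zero_le _).trans_lt hlt
  set q : ℝ := E / N with hq
  have hq0 : 0 ≤ q := by positivity
  have hq1 : q < 1 := by rw [hq, div_lt_one hN]; exact_mod_cast hlt
  have h3 : ∀ k : ℕ, 1 ≤ k → (1:ℝ) ≤ (k : ℝ) ^ M * q ^ k * ((r + 1 : ℕ) : ℝ) ^ M := by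
    intro k hk
    have h4 : (N:ℝ) ^ k ≤ E ^ k * (k * r + 1) ^ M := by exact_mod_cast h2 k
    have hk' : (1:ℝ) ≤ k := by exact_mod_cast hk
    have h5 : ((k:ℝ) * r + 1) ^ M ≤ (k * (r + 1 : ℕ)) ^ M := by
      gcongr
      push_cast
      nlinarith
    rw [hq, div_pow]
    rw [show (k:ℝ) ^ M * ((E:ℝ) ^ k / (N:ℝ) ^ k) * ((r + 1 : ℕ) : ℝ) ^ M
      = (E ^ k * (k * (r + 1 : ℕ)) ^ M) / (N:ℝ) ^ k by rw [mul_pow]; ring]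
    rw [le_div_iff₀ (by positivity), one_mul]
    exact h4.trans (by gcongr)
  have h6 := (tendsto_pow_const_mul_const_pow_of_lt_one M hq0 hq1).mul_const
    (((r + 1 : ℕ) : ℝ) ^ M)
  rw [zero_mul] at h6
  obtain ⟨k, hk, hk'⟩ := ((h6.eventually (gt_mem_nhds one_pos)).and
    (Filter.eventually_ge_atTop 1)).exists
  exact absurd (h3 k hk') (not_le.2 hk)

open MvPolynomial in
lemma bezout {σ : Type} [Fintype σ] [DecidableEq σ] (N e : ℕ) (he : 1 ≤ e)
    (G : σ → MvPolynomial σ ℝ) (hG : ∀ s, (G s).totalDegree ≤ e) (h : MvPolynomial σ ℝ)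
    (r : ℝ) (hr : 0 < r)
    (H : ∀ c : σ → ℝ, (∀ s, |c s| < r) → ∃ φ : Fin N → σ → ℝ,
      (∀ i s, eval (φ i) (G s) = c s) ∧ Function.Injective fun i => eval (φ i) h) :
    N ≤ e ^ Fintype.card σ := by
  refine growth N _ (N * h.totalDegree) (Fintype.card σ) (fun T => (expSet σ T).card)
    (card_expSet_pos 0) card_expSet_le fun T => ?_
  set q := N * h.totalDegree with hq
  refine le_trans ?_ (card_expSet_mul e he (T + q))
  let b : Fin N × expSet σ T → MvPolynomial σ ℝ := fun p => h ^ (p.1 : ℕ) * ∏ s, G s ^ p.2.1 s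
  have hb : ∀ p, (b p).totalDegree ≤ e * (T + q) := by
    intro p
    have h1 : (h ^ (p.1 : ℕ)).totalDegree ≤ q :=
      (totalDegree_pow _ _).trans (Nat.mul_le_mul_right _ p.1.2.le)
    have h2 : (∏ s, G s ^ p.2.1 s).totalDegree ≤ e * T := by
      refine (totalDegree_finsetProd _ _).trans ?_
      calc ∑ s, (G s ^ p.2.1 s).totalDegree ≤ ∑ s, p.2.1 s * e :=
            Finset.sum_le_sum fun s _ => (totalDegree_pow _ _).trans (Nat.mul_le_mul_left _ (hG s))
        _ = e * ∑ s, p.2.1 s := by rw [← Finset.sum_mul, mul_comm]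
        _ ≤ e * T := Nat.mul_le_mul_left _ (mem_expSet.1 p.2.2)
    refine (totalDegree_mul _ _).trans ?_
    nlinarith
  let Ψ : (Fin N × expSet σ T → ℝ) →ₗ[ℝ] MvPolynomial σ ℝ := Fintype.linearCombination ℝ b
  let K : MvPolynomial σ ℝ →ₗ[ℝ] (expSet σ (e * (T + q)) → ℝ) :=
    LinearMap.pi fun α => lcoeff ℝ (Finsupp.equivFunOnFinite.symm α.1)
  have hΨ : ∀ v, (Ψ v) = ∑ p, v p • b p := fun v => Fintype.linearCombination_apply _ _ _
  have hdeg : ∀ v, (Ψ v).totalDegree ≤ e * (T + q) := fun v => by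
    rw [hΨ]
    exact totalDegree_finsetSum_le fun p _ => (totalDegree_smul_le _ _).trans (hb p)
  have hinj : Function.Injective (K ∘ₗ Ψ) := by
    rw [← LinearMap.ker_eq_bot, LinearMap.ker_eq_bot']
    intro v hv
    have hz : Ψ v = 0 := by
      ext α
      rw [coeff_zero]
      by_cases hα : (⇑α) ∈ expSet σ (e * (T + q))
      · have := congrFun hv ⟨_, hα⟩
        simpa [K] using this
      · refine coeff_eq_zero_of_totalDegree_lt ((hdeg v).trans_lt ?_)
        rw [mem_expSet] at hα
        rw [Finset.sum_subset (subset_univ _) (by simp)]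
        omega
    let P : Fin N → MvPolynomial σ ℝ := fun j =>
      ∑ β : expSet σ T, monomial (Finsupp.equivFunOnFinite.symm β.1) (v (j, β))
    have hP : ∀ j, P j = 0 := by
      intro j
      refine funext_set (fun _ => Set.Ioo (-r) r) (fun _ => Set.Ioo_infinite (by linarith)) ?_
      intro c hc
      obtain ⟨φ, h1, h2⟩ := H c fun s => abs_lt.2 (hc s trivial)
      have := Matrix.eq_zero_of_forall_index_sum_pow_mul_eq_zero (v := fun j => eval c (P j)) h2 ?_
      · simpa using congrFun this j
      · intro i
        have h3 : eval (φ i) (Ψ v) = 0 := by rw [hz, map_zero]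
        rw [hΨ, map_sum, Fintype.sum_prod_type] at h3
        rw [← h3]
        refine Finset.sum_congr rfl fun j _ => ?_
        simp only [P, b, map_sum, Finset.mul_sum, smul_eval, map_mul, map_pow, map_prod, h1,
          eval_monomial]
        refine Finset.sum_congr rfl fun β _ => ?_
        rw [Finsupp.prod_fintype _ _ (by simp)]
        simp only [Finsupp.equivFunOnFinite_symm_apply_apply]
        ring
    funext ⟨j, β⟩
    have h4 := congrArg (coeff (Finsupp.equivFunOnFinite.symm β.1)) (hP j)
    simp only [P, coeff_sum, coeff_monomial, coeff_zero, EmbeddingLike.apply_eq_iff_eq,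
      Subtype.coe_inj] at h4
    simpa using h4
  have := LinearMap.finrank_le_finrank_of_injective hinj
  simpa using this

open MvPolynomial in
lemma totalDegree_pderiv_le' {σ : Type} [DecidableEq σ] (f : MvPolynomial σ ℝ) (s : σ) (D : ℕ)
    (hD : f.totalDegree ≤ D) : (pderiv s f).totalDegree ≤ D - 1 := by
  rw [f.as_sum, map_sum]
  refine totalDegree_finsetSum_le fun α hα => ?_
  rw [pderiv_monomial]
  by_cases h0 : α s = 0
  · simp [h0]
  refine (totalDegree_monomial_le _ _).trans ?_
  have h1 := (le_totalDegree hα).trans hD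
  have h2 : Finsupp.single s 1 ≤ α := by
    rw [Finsupp.single_le_iff]; omega
  have h3 : α - Finsupp.single s 1 + Finsupp.single s 1 = α := tsub_add_cancel_of_le h2
  have h4 : (α.sum fun _ e => e) = ((α - Finsupp.single s 1).sum fun _ e => e) + 1 := by
    conv_lhs => rw [← h3]
    rw [Finsupp.sum_add_index' (by simp) (by simp)]
    simp
  have h5 : ((α - Finsupp.single s 1).sum fun _ => id) =
    ((α - Finsupp.single s 1).sum fun _ e => e) := rfl
  omega

open MvPolynomial in
lemma hasDerivAt_eval {σ : Type} [DecidableEq σ] (f : MvPolynomial σ ℝ) (s : σ) (w : σ → ℝ)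
    (t : ℝ) : HasDerivAt (fun t => eval (Function.update w s t) f)
      (eval (Function.update w s t) (pderiv s f)) t := by
  induction f using MvPolynomial.induction_on with
  | C a => simpa using hasDerivAt_const t a
  | add p q hp hq =>
    have := hp.add hq
    simp only [map_add]
    exact this
  | mul_X p i hp =>
    have hX : HasDerivAt (fun t => eval (Function.update w s t) (X i))
        (eval (Function.update w s t) (pderiv s (X i))) t := by
      by_cases h : i = s
      · subst h
        simp only [eval_X, Function.update_self, pderiv_X_self, map_one]
        exact hasDerivAt_id t
      · simpa [pderiv_X, h, Ne.symm h, Pi.single_apply] using hasDerivAt_const t (w i)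
    have := hp.mul hX
    simp only [Derivation.leibniz, map_mul, map_add, smul_eq_mul]
    rw [add_comm, mul_comm (eval _ (X i))]
    exact this

open MvPolynomial in
lemma exists_poly_near {σ : Type} [Fintype σ] (B : Set (σ → ℝ)) (hB : IsCompact B)
    (u : (σ → ℝ) → ℝ) (hu : Continuous u) (ε : ℝ) (hε : 0 < ε) :
    ∃ h : MvPolynomial σ ℝ, ∀ w ∈ B, |eval w h - u w| < ε := by
  let ev : MvPolynomial σ ℝ →ₐ[ℝ] C(σ → ℝ, ℝ) :=
    MvPolynomial.aeval fun s => ⟨fun w => w s, continuous_apply s⟩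
  have hev : ∀ p w, ev p w = eval w p := by
    intro p w
    induction p using MvPolynomial.induction_on with
    | C a => simp [ev]
    | add p q hp hq => simp [hp, hq]
    | mul_X p i hp => simp [hp]; simp [ev]
  have hsep : ev.range.SeparatesPoints := by
    intro x y hxy
    obtain ⟨s, hs⟩ := Function.ne_iff.1 hxy
    exact ⟨fun w => w s, ⟨ev (X s), ⟨X s, rfl⟩, by ext w; simp [hev]⟩, hs⟩
  obtain ⟨g, hg, hg'⟩ :=
    ContinuousMap.exists_mem_subalgebra_near_continuous_of_isCompact_of_separatesPoints
      hsep ⟨u, hu⟩ hB hε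
  obtain ⟨p, rfl⟩ := hg
  refine ⟨p, fun w hw => ?_⟩
  have : ‖ev p w - u w‖ < ε := hg' w hw
  rw [hev] at this
  simpa using this

open MvPolynomial in
lemma zero_comp_bound {σ : Type} [Fintype σ] [DecidableEq σ] (f : MvPolynomial σ ℝ) (D : ℕ)
    (hD : 2 ≤ D) (hfD : f.totalDegree ≤ D) (hf : ∀ w, 0 ≤ eval w f) (u : (σ → ℝ) → ℝ)
    (hu : Continuous u) (N : ℕ) (hval : ∀ w, eval w f = 0 → ∃ k : Fin N, u w = (k : ℕ))
    (hsurj : ∀ k : Fin N, ∃ w, eval w f = 0 ∧ u w = (k : ℕ)) :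
    N ≤ (D - 1) ^ Fintype.card σ := by
  choose w₀ hw₀ huw₀ using hsurj
  let ρ : (σ → ℝ) → ℝ := fun w => ∑ s, w s ^ 2
  have hρ : Continuous ρ := by fun_prop
  have hρ0 : ∀ w, 0 ≤ ρ w := fun w => Finset.sum_nonneg fun s _ => sq_nonneg _
  have hfc : Continuous fun w => eval w f := MvPolynomial.continuous_eval f
  let R : ℝ := ∑ k, ρ (w₀ k)
  have hR : ∀ k, ρ (w₀ k) ≤ R := fun k =>
    Finset.single_le_sum (f := fun k => ρ (w₀ k)) (fun k _ => hρ0 _) (mem_univ k)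
  have hR0 : 0 ≤ R := Finset.sum_nonneg fun k _ => hρ0 _
  let B : Set (σ → ℝ) := {w | ρ w ≤ R + 1}
  have hBcl : IsClosed B := isClosed_le hρ continuous_const
  have hB : IsCompact B := by
    refine Metric.isCompact_of_isClosed_isBounded hBcl ?_
    refine (Metric.isBounded_iff_subset_closedBall 0).2 ⟨R + 2, fun w hw => ?_⟩
    rw [mem_closedBall_zero_iff, pi_norm_le_iff_of_nonneg (by linarith)]
    intro s
    have h1 : w s ^ 2 ≤ ρ w :=
      Finset.single_le_sum (f := fun s => w s ^ 2) (fun s _ => sq_nonneg _) (mem_univ s)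
    have h2 : ρ w ≤ R + 1 := hw
    rw [Real.norm_eq_abs, abs_le]
    constructor <;> nlinarith
  obtain ⟨h, hh⟩ := exists_poly_near B hB u hu (1/4) (by norm_num)
  -- positive lower bound for `f` on the walls
  obtain ⟨η, hη, hηf⟩ : ∃ η > 0, ∀ w ∈ B, ∀ k : Fin N, |u w - (k : ℕ)| = 1/4 → η ≤ eval w f := by
    let Z : Set (σ → ℝ) := B ∩ ⋃ k : Fin N, {w | |u w - (k : ℕ)| = 1/4}
    have hZ : IsCompact Z := hB.inter_right (isClosed_iUnion_of_finite fun k =>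
      isClosed_eq (by fun_prop) continuous_const)
    rcases Z.eq_empty_or_nonempty with hZe | hZne
    · refine ⟨1, one_pos, fun w hw k hk => ?_⟩
      have : w ∈ Z := ⟨hw, Set.mem_iUnion.2 ⟨k, hk⟩⟩
      rw [hZe] at this
      exact this.elim
    · obtain ⟨z, hz, hz'⟩ := hZ.exists_isMinOn hZne hfc.continuousOn
      refine ⟨eval z f, lt_of_le_of_ne (hf z) ?_, fun w hw k hk =>
        hz' (show w ∈ Z from ⟨hw, Set.mem_iUnion.2 ⟨k, hk⟩⟩)⟩
      intro h0
      obtain ⟨j, hj⟩ := hval z h0.symm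
      obtain ⟨k, hk⟩ := Set.mem_iUnion.1 hz.2
      have hk : |u z - (k : ℕ)| = 1/4 := hk
      rw [hj] at hk
      have h1 : |(((j : ℕ) : ℤ) - ((k : ℕ) : ℤ) : ℤ)| * 4 = 1 := by
        have : (|(((j : ℕ) : ℤ) - ((k : ℕ) : ℤ) : ℤ)| : ℝ) * 4 = 1 := by
          push_cast
          rw [hk]; norm_num
        exact_mod_cast this
      omega
  let ε := η / (R + 1)
  have hε : 0 < ε := by positivity
  have hεη : ε * (R + 1) = η := by simp only [ε]; field_simp
  let M : ℝ := Fintype.card σ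
  have hM : 0 ≤ M := by positivity
  let r := ε / (3 * (M + R + 1))
  have hr : 0 < r := by positivity
  have hrε : r * (M + R + 1) = ε / 3 := by simp only [r]; field_simp
  let g : MvPolynomial σ ℝ := f + C ε * ∑ s, X s ^ 2
  have hg : ∀ w, eval w g = eval w f + ε * ρ w := by intro w; simp [g, ρ]
  have hgD : g.totalDegree ≤ D := by
    refine (totalDegree_add _ _).trans (max_le hfD ?_)
    refine (totalDegree_mul _ _).trans ?_
    rw [totalDegree_C, zero_add]
    exact totalDegree_finsetSum_le fun s _ => by rw [totalDegree_X_pow]; exact hD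
  refine bezout N (D - 1) (by omega) (fun s => pderiv s g)
    (fun s => totalDegree_pderiv_le' g s D hgD) h r hr ?_
  intro c hc
  have hcw : ∀ w ∈ B, |∑ s, c s * w s| ≤ ε / 3 := by
    intro w hw
    have hw : ρ w ≤ R + 1 := hw
    calc |∑ s, c s * w s| ≤ ∑ s, |c s * w s| := Finset.abs_sum_le_sum_abs _ _
      _ ≤ ∑ s, r * (1 + w s ^ 2) := by
        refine Finset.sum_le_sum fun s _ => ?_
        rw [abs_mul]
        have : |w s| ≤ 1 + w s ^ 2 := by
          rw [← sq_abs]; nlinarith [sq_nonneg (|w s| - 1), abs_nonneg (w s)]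
        exact mul_le_mul (hc s).le this (abs_nonneg _) hr.le
      _ = r * (M + ρ w) := by
        rw [← Finset.mul_sum, Finset.sum_add_distrib]; simp [M, ρ]
      _ ≤ r * (M + R + 1) := mul_le_mul_of_nonneg_left (by linarith) hr.le
      _ = ε / 3 := hrε
  let F : MvPolynomial σ ℝ := g - ∑ s, C (c s) * X s
  have hF : ∀ w, eval w F = eval w f + ε * ρ w - ∑ s, c s * w s := by
    intro w; simp only [F, map_sub, hg]; simp
  have key : ∀ k : Fin N, ∃ w, ρ w ≤ R + 1 ∧ |u w - (k : ℕ)| < 1/4 ∧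
      ∀ s, eval w (pderiv s g) = c s := by
    intro k
    let Kk : Set (σ → ℝ) := B ∩ {w | |u w - (k : ℕ)| ≤ 1/4}
    have hK : IsCompact Kk := hB.inter_right (isClosed_le (by fun_prop) continuous_const)
    have hmem : w₀ k ∈ Kk := ⟨show ρ (w₀ k) ≤ R + 1 by linarith [hR k], by
      simp [huw₀]⟩
    have hFc : Continuous fun w => eval w F := MvPolynomial.continuous_eval F
    obtain ⟨w, hw, hmin⟩ := hK.exists_isMinOn ⟨_, hmem⟩ hFc.continuousOn
    have h1 : eval w F ≤ eval (w₀ k) F := hmin hmem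
    rw [hF, hF, hw₀] at h1
    have h2 := abs_le.1 (hcw w hw.1)
    have h3 := abs_le.1 (hcw _ hmem.1)
    have h4 : ε * ρ (w₀ k) ≤ ε * R := by gcongr; exact hR k
    have hwB : ρ w ≤ R + 1 := hw.1
    have hwu : |u w - (k : ℕ)| ≤ 1/4 := hw.2
    have h5 : ρ w < R + 1 := by
      refine lt_of_le_of_ne hwB fun h5 => ?_
      rw [h5] at h1
      have := hf w
      nlinarith
    have h6 : |u w - (k : ℕ)| < 1/4 := by
      refine lt_of_le_of_ne hwu fun h6 => ?_
      have h7 := hηf w hwB k h6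
      have := mul_nonneg hε.le (hρ0 w)
      nlinarith
    refine ⟨w, hwB, h6, fun s => ?_⟩
    have hloc : IsLocalMin (fun w => eval w F) w := by
      have ho : IsOpen {w | ρ w < R + 1 ∧ |u w - (k : ℕ)| < 1/4} :=
        (isOpen_lt hρ continuous_const).inter
          (isOpen_lt (hu.sub continuous_const).abs continuous_const)
      filter_upwards [ho.mem_nhds ⟨h5, h6⟩] with z hz
      exact hmin (show z ∈ Kk from ⟨hz.1.le, hz.2.le⟩)
    have hloc2 : IsLocalMin (fun t => eval (Function.update w s t) F) (w s) := by
      have hcont : ContinuousAt (fun t : ℝ => Function.update w s t) (w s) := by fun_prop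
      have ht : Filter.Tendsto (fun t : ℝ => Function.update w s t) (nhds (w s)) (nhds w) := by
        have := hcont.tendsto
        rwa [Function.update_eq_self] at this
      have := ht.eventually hloc
      filter_upwards [this] with t ht
      simpa using ht
    have h8 := hloc2.hasDerivAt_eq_zero (hasDerivAt_eval F s w (w s))
    rw [Function.update_eq_self] at h8
    have h9 : eval w (pderiv s F) = eval w (pderiv s g) - c s := by
      simp [F, pderiv_X, Pi.single_apply]
    linarith
  choose φ h1 h2 h3 using key
  refine ⟨φ, h3, fun i j hij => ?_⟩
  have hij : eval (φ i) h = eval (φ j) h := hij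
  have a1 := abs_lt.1 (hh _ (h1 i))
  have a2 := abs_lt.1 (hh _ (h1 j))
  have a3 := abs_lt.1 (h2 i)
  have a4 := abs_lt.1 (h2 j)
  have b1 : ((i : ℕ) : ℝ) < (j : ℕ) + 1 := by linarith
  have b2 : ((j : ℕ) : ℝ) < (i : ℕ) + 1 := by linarith
  have b1 : (i : ℕ) < (j : ℕ) + 1 := by exact_mod_cast b1
  have b2 : (j : ℕ) < (i : ℕ) + 1 := by exact_mod_cast b2
  ext
  omega

lemma components_bound {X : Type} [TopologicalSpace X] (S : Set X) (B : ℕ)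
    (H : ∀ (N : ℕ) (u : S → Fin N), Continuous u → Function.Surjective u → N ≤ B) :
    {C : Set X | ∃ x ∈ S, C = connectedComponentIn S x}.Finite ∧
    {C : Set X | ∃ x ∈ S, C = connectedComponentIn S x}.ncard ≤ B := by
  classical
  rcases S.eq_empty_or_nonempty with hS | hS
  · subst hS; simp
  let Q : ℕ → Prop := fun N => ∃ u : S → Fin N, Continuous u ∧ Function.Surjective u
  have hQ : ∀ N, Q N → N ≤ B := fun N ⟨u, h1, h2⟩ => H N u h1 h2
  have hQ1 : Q 1 := ⟨fun _ => 0, continuous_const, fun k => ⟨⟨_, hS.some_mem⟩, by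
    exact (Subsingleton.elim _ _)⟩⟩
  obtain ⟨u, huc, hus⟩ : Q (Nat.findGreatest Q B) := Nat.findGreatest_spec (hQ 1 hQ1) hQ1
  have hmax : ¬ Q (Nat.findGreatest Q B + 1) := fun h =>
    absurd (Nat.le_findGreatest (hQ _ h) h) (by omega)
  have hNB : Nat.findGreatest Q B ≤ B := Nat.findGreatest_le B
  generalize Nat.findGreatest Q B = N at *
  have hconn : ∀ j, IsPreconnected (u ⁻¹' {j}) := by
    intro j
    refine isPreconnected_of_forall_constant fun f hf => ?_
    by_contra hne
    push Not at hne
    obtain ⟨x, hx, y, hy, hxy⟩ := hne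
    have hx : u x = j := hx
    have hy : u y = j := hy
    apply hmax
    have hop : IsOpen (u ⁻¹' {j}) := (isOpen_discrete _).preimage huc
    have hcl : IsClosed (u ⁻¹' {j}) := (isClosed_discrete _).preimage huc
    let W : Set S := {z | u z = j ∧ f z = f x}
    have hWo : IsOpen W := by
      have := hf.isOpen_inter_preimage hop (isOpen_discrete {f x})
      exact this
    have hWc : IsClosed W := by
      have := hf.preimage_isClosed_of_isClosed hcl (isClosed_discrete {f x})
      exact this
    refine ⟨fun z => if z ∈ W then Fin.last N else (u z).castSucc, ?_, ?_⟩
    · refine continuous_if ?_ ?_ ?_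
      · intro a ha
        have : frontier {a | a ∈ W} = ∅ := IsClopen.frontier_eq ⟨hWc, hWo⟩
        rw [this] at ha
        exact ha.elim
      · exact continuousOn_const
      · exact (continuous_of_discreteTopology.comp huc).continuousOn
    · intro k
      refine Fin.lastCases ?_ (fun i => ?_) k
      · exact ⟨x, if_pos ⟨hx, rfl⟩⟩
      · by_cases hij : i = j
        · refine ⟨y, ?_⟩
          have : y ∉ W := fun h => hxy h.2.symm
          simp only [if_neg this, hy, hij]
        · obtain ⟨z, hz⟩ := hus i
          refine ⟨z, ?_⟩
          have : z ∉ W := fun h => hij (hz ▸ h.1)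
          simp only [if_neg this, hz]
  have heq : ∀ x y : S, u x = u y → connectedComponentIn S (x : X) = connectedComponentIn S y := by
    intro x y hxy
    have h1 : IsPreconnected (Subtype.val '' (u ⁻¹' {u y})) :=
      (hconn (u y)).image _ continuous_subtype_val.continuousOn
    have h2 := h1.subset_connectedComponentIn (F := S) (x := (x : X)) ⟨x, hxy, rfl⟩ (by
      rintro _ ⟨z, _, rfl⟩; exact z.2)
    exact connectedComponentIn_eq (h2 ⟨y, rfl, rfl⟩)
  choose v hv using hus
  have hsub : {C : Set X | ∃ x ∈ S, C = connectedComponentIn S x} ⊆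
      Set.range fun k : Fin N => connectedComponentIn S (v k : X) := by
    rintro C ⟨x, hx, rfl⟩
    exact ⟨u ⟨x, hx⟩, heq (v (u ⟨x, hx⟩)) ⟨x, hx⟩ (hv _)⟩
  refine ⟨(Set.finite_range _).subset hsub, ?_⟩
  refine (Set.ncard_le_ncard hsub (Set.finite_range _)).trans ?_
  rw [← Set.image_univ]
  refine (Set.ncard_image_le Set.finite_univ).trans ?_
  rw [Set.ncard_univ]
  simpa using hNB

open MvPolynomial in
/-- the polynomial `(A x^k + a)_i` in the variables `x, y, z` -/
noncomputable def polyF {n k : ℕ} (A : Fin n → (Fin k → Fin n) → ℝ) (a : Fin n → ℝ) (i : Fin n) :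
    MvPolynomial (Fin n × Fin 3) ℝ :=
  ∑ j : Fin k → Fin n, C (A i j) * ∏ l : Fin k, X (j l, 0) + C (a i)

open MvPolynomial in
/-- sum of squares whose zero set projects onto the solution set -/
noncomputable def polySol {n k : ℕ} (A : Fin n → (Fin k → Fin n) → ℝ) (a : Fin n → ℝ) :
    MvPolynomial (Fin n × Fin 3) ℝ :=
  ∑ i, ((X (i, 0) - X (i, 1) ^ 2) ^ 2 + (polyF A a i - X (i, 2) ^ 2) ^ 2 + (X (i, 1) * X (i, 2)) ^ 2)

open MvPolynomial in
lemma eval_polyF {n k : ℕ} (A : Fin n → (Fin k → Fin n) → ℝ) (a : Fin n → ℝ) (i : Fin n)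
    (w : Fin n × Fin 3 → ℝ) :
    eval w (polyF A a i) = tApply A (fun i => w (i, 0)) i + a i := by
  simp [polyF, tApply]

open MvPolynomial in
lemma eval_polySol {n k : ℕ} (A : Fin n → (Fin k → Fin n) → ℝ) (a : Fin n → ℝ)
    (w : Fin n × Fin 3 → ℝ) :
    eval w (polySol A a) = ∑ i, ((w (i, 0) - w (i, 1) ^ 2) ^ 2 +
      ((tApply A (fun i => w (i, 0)) i + a i) - w (i, 2) ^ 2) ^ 2 + (w (i, 1) * w (i, 2)) ^ 2) := by
  simp [polySol, eval_polyF]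

open MvPolynomial in
lemma totalDegree_polyF {n k : ℕ} (A : Fin n → (Fin k → Fin n) → ℝ) (a : Fin n → ℝ) (i : Fin n) :
    (polyF A a i).totalDegree ≤ k := by
  refine (totalDegree_add _ _).trans (max_le ?_ (by simp))
  refine totalDegree_finsetSum_le fun j _ => (totalDegree_mul _ _).trans ?_
  rw [totalDegree_C, zero_add]
  refine (totalDegree_finsetProd _ _).trans ?_
  simp

open MvPolynomial in
lemma totalDegree_polySol {n k : ℕ} (A : Fin n → (Fin k → Fin n) → ℝ) (a : Fin n → ℝ) (d : ℕ)
    (hd : 2 ≤ d) (hk : k ≤ d) : (polySol A a).totalDegree ≤ 2 * d := by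
  have hsq : ∀ p : MvPolynomial (Fin n × Fin 3) ℝ, p.totalDegree ≤ d →
      (p ^ 2).totalDegree ≤ 2 * d := fun p hp =>
    (totalDegree_pow _ _).trans (Nat.mul_le_mul_left _ hp)
  have hX : ∀ s : Fin n × Fin 3, ((X s : MvPolynomial (Fin n × Fin 3) ℝ) ^ 2).totalDegree ≤ d :=
    fun s => by rw [totalDegree_X_pow]; exact hd
  refine totalDegree_finsetSum_le fun i _ => ?_
  refine (totalDegree_add _ _).trans (max_le ((totalDegree_add _ _).trans (max_le ?_ ?_)) ?_)
  · refine hsq _ ((totalDegree_sub _ _).trans (max_le ?_ (hX _)))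
    rw [totalDegree_X]; omega
  · exact hsq _ ((totalDegree_sub _ _).trans (max_le ((totalDegree_polyF A a i).trans hk) (hX _)))
  · refine hsq _ ((totalDegree_mul _ _).trans ?_)
    rw [totalDegree_X, totalDegree_X]; omega

lemma polySol_zero {n k : ℕ} (A : Fin n → (Fin k → Fin n) → ℝ) (a : Fin n → ℝ)
    (w : Fin n × Fin 3 → ℝ) (h : MvPolynomial.eval w (polySol A a) = 0) :
    (fun i => w (i, 0)) ∈ Sol A a := by
  rw [eval_polySol, Finset.sum_eq_zero_iff_of_nonneg (fun i _ => by positivity)] at h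
  have h' : ∀ i, w (i, 0) = w (i, 1) ^ 2 ∧
      tApply A (fun i => w (i, 0)) i + a i = w (i, 2) ^ 2 ∧ w (i, 1) * w (i, 2) = 0 := by
    intro i
    have h0 := h i (mem_univ i)
    have p1 := sq_nonneg (w (i, 0) - w (i, 1) ^ 2)
    have p2 := sq_nonneg ((tApply A (fun i => w (i, 0)) i + a i) - w (i, 2) ^ 2)
    have p3 := sq_nonneg (w (i, 1) * w (i, 2))
    refine ⟨sub_eq_zero.1 (pow_eq_zero_iff two_ne_zero |>.1 ?_),
      sub_eq_zero.1 (pow_eq_zero_iff two_ne_zero |>.1 ?_), pow_eq_zero_iff two_ne_zero |>.1 ?_⟩ <;>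
    linarith
  refine ⟨fun i => ?_, fun i => ?_, Finset.sum_eq_zero fun i _ => ?_⟩
  · show 0 ≤ w (i, 0)
    rw [(h' i).1]; positivity
  · rw [(h' i).2.1]; positivity
  · show w (i, 0) * _ = 0
    rw [(h' i).2.1, (h' i).1, ← mul_pow, (h' i).2.2]; simp

lemma exists_polySol_zero {n k : ℕ} (A : Fin n → (Fin k → Fin n) → ℝ) (a : Fin n → ℝ)
    (x : Fin n → ℝ) (hx : x ∈ Sol A a) :
    ∃ w : Fin n × Fin 3 → ℝ, MvPolynomial.eval w (polySol A a) = 0 ∧ (fun i => w (i, 0)) = x := by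
  obtain ⟨h1, h2, h3⟩ := hx
  rw [Finset.sum_eq_zero_iff_of_nonneg fun i _ => mul_nonneg (h1 i) (h2 i)] at h3
  refine ⟨fun p => ![x p.1, √(x p.1), √(tApply A x p.1 + a p.1)] p.2, ?_, ?_⟩
  · rw [eval_polySol]
    refine Finset.sum_eq_zero fun i _ => ?_
    have := h3 i (mem_univ i)
    simp only [Matrix.cons_val]
    rw [Real.sq_sqrt (h1 i), Real.sq_sqrt (h2 i), ← Real.sqrt_mul (h1 i), this]
    simp
  · rfl

lemma isClosed_Sol {n k : ℕ} (A : Fin n → (Fin k → Fin n) → ℝ) (a : Fin n → ℝ) :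
    IsClosed (Sol A a) := by
  have hc : ∀ i, Continuous fun x => tApply A x i + a i := by
    intro i; unfold tApply; fun_prop
  have e : Sol A a = (⋂ i, {x | 0 ≤ x i}) ∩ ((⋂ i, {x | 0 ≤ tApply A x i + a i}) ∩
      {x | ∑ i, x i * (tApply A x i + a i) = 0}) := by
    ext x; simp [Sol]
  rw [e]
  refine (isClosed_iInter fun i => isClosed_le continuous_const (continuous_apply i)).inter
    ((isClosed_iInter fun i => isClosed_le continuous_const (hc i)).inter
    (isClosed_eq (continuous_finsetSum _ fun i _ => (continuous_apply i).mul (hc i))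
      continuous_const))

/-- the number of connected components of `Sol(A,a)` does not exceed
`d(2d-1)^(5n)` where `d = max 2 (m-1)`. -/
theorem stmt_9 (m n : ℕ) (hm : 2 ≤ m) (hn : 2 ≤ n) (A : Fin n → (Fin (m - 1) → Fin n) → ℝ) (a : Fin n → ℝ) :
    {C : Set (Fin n → ℝ) | ∃ x ∈ Sol A a, C = connectedComponentIn (Sol A a) x}.Finite ∧
    {C : Set (Fin n → ℝ) | ∃ x ∈ Sol A a, C = connectedComponentIn (Sol A a) x}.ncard ≤
      (max 2 (m - 1)) * (2 * (max 2 (m - 1)) - 1) ^ (5 * n) := by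
  have hd : 2 ≤ max 2 (m - 1) := le_max_left _ _
  have hk : m - 1 ≤ max 2 (m - 1) := le_max_right _ _
  generalize max 2 (m - 1) = d at *
  refine components_bound _ _ fun N u huc hus => ?_
  obtain ⟨U, hU⟩ := ContinuousMap.exists_restrict_eq (Y := ℝ) (isClosed_Sol A a)
    ⟨fun x => ((u x : ℕ) : ℝ), (continuous_of_discreteTopology (f := fun k : Fin N =>
      ((k : ℕ) : ℝ))).comp huc⟩
  have hU' : ∀ x : Sol A a, U x = ((u x : ℕ) : ℝ) := fun x => by
    have := DFunLike.congr_fun hU x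
    simpa using this
  have := zero_comp_bound (polySol A a) (2 * d) (by omega) (totalDegree_polySol A a d hd hk)
    (fun w => by rw [eval_polySol]; exact Finset.sum_nonneg fun i _ => by positivity)
    (fun w => U fun i => w (i, 0)) (by fun_prop) N
    (fun w hw => ⟨u ⟨_, polySol_zero A a w hw⟩, hU' ⟨_, polySol_zero A a w hw⟩⟩)
    (fun k => by
      obtain ⟨x, hx⟩ := hus k
      obtain ⟨w, hw, hwx⟩ := exists_polySol_zero A a x x.2
      exact ⟨w, hw, by rw [hwx, hU', hx]⟩)
  refine this.trans ?_
  rw [Fintype.card_prod, Fintype.card_fin, Fintype.card_fin]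
  calc (2 * d - 1) ^ (n * 3) ≤ (2 * d - 1) ^ (5 * n) :=
        Nat.pow_le_pow_right (by omega) (by omega)
    _ ≤ d * (2 * d - 1) ^ (5 * n) := Nat.le_mul_of_pos_left _ (by omega)
end

section
/- Assume A is an R0-tensor and the map F(x) = A x^{m-1} is monotone on ℝ^n_+, i.e., ⟨F(y) − F(x), y − x⟩ ≥ 0 for all x, y ≥ 0. Then there exists a set S ⊆ ℝ^n, dense in ℝ^n and with complement of Lebesgue measure zero, such that for every a ∈ S the solution set Sol(A,a) is a singleton {s(a)}, and the map a ↦ s(a) is continuous on S. -/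
open Finset MeasureTheory Pointwise

theorem minty_exists {n : ℕ} (K : Set (Fin n → ℝ)) (hK : IsCompact K) (hc : Convex ℝ K) (hne : K.Nonempty)
    (F : (Fin n → ℝ) → (Fin n → ℝ))
    (hm : ∀ x ∈ K, ∀ y ∈ K, 0 ≤ (F y - F x) ⬝ᵥ (y - x)) :
    ∃ x ∈ K, ∀ y ∈ K, 0 ≤ F y ⬝ᵥ (y - x) := by
  have key := hK.inter_iInter_nonempty (fun y : K => {x : Fin n → ℝ | 0 ≤ F y ⬝ᵥ ((y : Fin n → ℝ) - x)})
    (fun y => isClosed_le continuous_const (by unfold dotProduct; fun_prop)) ?_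
  · obtain ⟨x, hx, hx2⟩ := key
    refine ⟨x, hx, fun y hy => ?_⟩
    simp only [Set.mem_iInter] at hx2
    exact hx2 ⟨y, hy⟩
  intro t
  by_contra hcon
  let G : (Fin n → ℝ) → (t → ℝ) := fun x j => F j.1 ⬝ᵥ ((j.1 : Fin n → ℝ) - x)
  have hG : Continuous G := by unfold G dotProduct; fun_prop
  have hGc : Convex ℝ (G '' K) := by
    rintro _ ⟨x, hx, rfl⟩ _ ⟨y, hy, rfl⟩ a b ha hb hab
    refine ⟨a • x + b • y, hc hx hy ha hb hab, ?_⟩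
    funext j
    simp only [G, dotProduct_sub, dotProduct_add, dotProduct_smul, Pi.add_apply, Pi.smul_apply, smul_eq_mul]
    linear_combination (-(F j.1 ⬝ᵥ (j.1 : Fin n → ℝ))) * hab
  have hP : Convex ℝ (Set.Ici (0 : t → ℝ)) := convex_Ici _
  have hdis : Disjoint (G '' K) (Set.Ici (0 : t → ℝ)) := by
    rw [Set.disjoint_left]
    rintro _ ⟨x, hx, rfl⟩ h
    apply hcon
    refine ⟨x, hx, ?_⟩
    simp only [Set.mem_iInter]
    intro y hy
    exact h ⟨y, hy⟩
  obtain ⟨f, u, v, h1, huv, h2⟩ := geometric_hahn_banach_compact_closed hGc (hK.image hG) hP isClosed_Ici hdis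
  have hv : v < 0 := by simpa using h2 0 (by simp)
  set μ : t → ℝ := fun j => f (Pi.single j 1) with hμ
  have hf : ∀ w, f w = ∑ j, w j * μ j := by
    intro w
    conv_lhs => rw [pi_eq_sum_univ' w]
    simp [hμ, map_sum, Pi.single]
  have hμ0 : ∀ j, 0 ≤ μ j := by
    intro j
    by_contra hj
    push Not at hj
    have := h2 ((v / μ j) • Pi.single j 1) (by
      have : 0 ≤ v / μ j := div_nonneg_of_nonpos hv.le hj.le
      intro i
      by_cases h : i = j
      · subst h; simpa using this
      · simp [h])
    rw [map_smul] at this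
    simp only [smul_eq_mul] at this
    change v < v / μ j * μ j at this
    rw [div_mul_cancel₀ _ hj.ne] at this
    exact lt_irrefl _ this
  have hneg : ∀ x ∈ K, ∑ j, G x j * μ j < 0 := by
    intro x hx
    rw [← hf]
    linarith [h1 (G x) ⟨x, hx, rfl⟩]
  -- some μ positive
  have hex : ∃ j, 0 < μ j := by
    by_contra h
    push Not at h
    obtain ⟨x, hx⟩ := hne
    have := hneg x hx
    have hz : ∀ j, μ j = 0 := fun j => le_antisymm (h j) (hμ0 j)
    simp [hz] at this
  have hlt : ∑ i : t, μ i * ∑ j, G (i.1 : K) j * μ j < 0 := by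
    obtain ⟨j, hj⟩ := hex
    apply Finset.sum_neg'
    · intro i _
      exact mul_nonpos_of_nonneg_of_nonpos (hμ0 i) (hneg _ i.1.2).le
    · exact ⟨j, Finset.mem_univ _, mul_neg_of_pos_of_neg hj (hneg _ j.1.2)⟩
  have e1 : ∑ i : t, μ i * ∑ j, G (i.1 : K) j * μ j = ∑ i : t, ∑ j : t, μ i * μ j * G (i.1 : K) j := by
    refine Finset.sum_congr rfl fun i _ => ?_
    rw [Finset.mul_sum]
    exact Finset.sum_congr rfl fun j _ => by ring
  have e2 : ∑ i : t, ∑ j : t, μ i * μ j * G (i.1 : K) j = ∑ i : t, ∑ j : t, μ i * μ j * G (j.1 : K) i := by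
    rw [Finset.sum_comm]
    exact Finset.sum_congr rfl fun i _ => Finset.sum_congr rfl fun j _ => by ring
  have e3 : 0 ≤ ∑ i : t, ∑ j : t, μ i * μ j * G (i.1 : K) j + ∑ i : t, ∑ j : t, μ i * μ j * G (j.1 : K) i := by
    rw [← Finset.sum_add_distrib]
    refine Finset.sum_nonneg fun i _ => ?_
    rw [← Finset.sum_add_distrib]
    refine Finset.sum_nonneg fun j _ => ?_
    rw [← mul_add]
    refine mul_nonneg (mul_nonneg (hμ0 i) (hμ0 j)) ?_
    have := hm _ i.1.2 _ j.1.2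
    have e : G (i.1 : K) j + G (j.1 : K) i = (F j.1 - F i.1) ⬝ᵥ ((j.1 : Fin n → ℝ) - i.1) := by
      simp only [G, dotProduct_sub, sub_dotProduct]; ring
    rw [e]; exact this
  linarith

theorem minty_imp {n : ℕ} (K : Set (Fin n → ℝ)) (hc : Convex ℝ K)
    (F : (Fin n → ℝ) → (Fin n → ℝ)) (hF : Continuous F) (x : Fin n → ℝ) (hx : x ∈ K)
    (h : ∀ y ∈ K, 0 ≤ F y ⬝ᵥ (y - x)) : ∀ y ∈ K, 0 ≤ F x ⬝ᵥ (y - x) := by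
  intro y hy
  have hcont : Continuous (fun t : ℝ => F (x + t • (y - x)) ⬝ᵥ (y - x)) := by
    have : Continuous (fun t : ℝ => F (x + t • (y - x))) := by fun_prop
    unfold dotProduct
    fun_prop
  have ht := (hcont.tendsto 0).mono_left (nhdsWithin_le_nhds (s := Set.Ioi 0))
  simp only [zero_smul, add_zero] at ht
  refine ge_of_tendsto ht ?_
  filter_upwards [Ioo_mem_nhdsGT (show (0:ℝ) < 1 by norm_num)] with t ht
  have := h (x + t • (y - x)) (hc.add_smul_sub_mem hx hy ⟨ht.1.le, ht.2.le⟩)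
  rw [add_sub_cancel_left, dotProduct_smul, smul_eq_mul] at this
  exact nonneg_of_mul_nonneg_right this ht.1

theorem tApply_continuous {n k : ℕ} (A : Fin n → (Fin k → Fin n) → ℝ) : Continuous (tApply A) := by
  unfold tApply; fun_prop

theorem tApply_differentiable {n k : ℕ} (A : Fin n → (Fin k → Fin n) → ℝ) :
    Differentiable ℝ (tApply A) := by
  unfold tApply
  rw [differentiable_pi]
  intro i
  fun_prop

theorem tApply_smul {n k : ℕ} (A : Fin n → (Fin k → Fin n) → ℝ) (r : ℝ) (x : Fin n → ℝ) :
    tApply A (r • x) = r ^ k • tApply A x := by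
  funext i
  simp only [tApply, Pi.smul_apply, smul_eq_mul, Finset.prod_mul_distrib, Finset.prod_const,
    Finset.card_univ, Fintype.card_fin, Finset.mul_sum]
  exact Finset.sum_congr rfl fun j _ => by ring

theorem sol_smul {n k : ℕ} (A : Fin n → (Fin k → Fin n) → ℝ) (a x : Fin n → ℝ) (r : ℝ) (hr : 0 < r)
    (hx : x ∈ Sol A a) : r • x ∈ Sol A (r ^ k • a) := by
  obtain ⟨h1, h2, h3⟩ := hx
  refine ⟨fun i => mul_nonneg hr.le (h1 i), fun i => ?_, ?_⟩
  · rw [tApply_smul]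
    simp only [Pi.smul_apply, smul_eq_mul, ← mul_add]
    exact mul_nonneg (by positivity) (h2 i)
  · rw [tApply_smul]
    simp only [Pi.smul_apply, smul_eq_mul, ← mul_add]
    calc _ = (r * r ^ k) * ∑ i, x i * (tApply A x i + a i) := by
            rw [Finset.mul_sum]; exact Finset.sum_congr rfl fun j _ => by ring
      _ = 0 := by rw [h3, mul_zero]

theorem sol_iff {n k : ℕ} (A : Fin n → (Fin k → Fin n) → ℝ) (a x : Fin n → ℝ) :
    x ∈ Sol A a ↔ 0 ≤ x ∧ ∀ y, 0 ≤ y → 0 ≤ (tApply A x + a) ⬝ᵥ (y - x) := by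
  constructor
  · rintro ⟨h1, h2, h3⟩
    refine ⟨h1, fun y hy => ?_⟩
    have h4 : (tApply A x + a) ⬝ᵥ x = 0 := by
      rw [dotProduct_comm]; exact h3
    rw [dotProduct_sub, h4, sub_zero]
    exact dotProduct_nonneg_of_nonneg h2 hy
  · rintro ⟨h1, h2⟩
    have h3 : ∀ i, 0 ≤ tApply A x i + a i := by
      intro i
      have := h2 (x + Pi.single i 1) (add_nonneg h1 (by simp [Pi.single_nonneg]))
      simpa using this
    refine ⟨h1, h3, ?_⟩
    have h4 := h2 0 le_rfl
    have h5 : 0 ≤ (tApply A x + a) ⬝ᵥ x := dotProduct_nonneg_of_nonneg h3 h1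
    rw [zero_sub, dotProduct_neg] at h4
    have : x ⬝ᵥ (tApply A x + a) = 0 := by rw [dotProduct_comm]; linarith
    exact this

/-- The unit truncated orthant. -/
def KK (n : ℕ) : Set (Fin n → ℝ) := {x | 0 ≤ x ∧ ∑ i, x i ≤ 1}

theorem KK_closed (n : ℕ) : IsClosed (KK n) :=
  (isClosed_le continuous_const continuous_id).inter
    (isClosed_le (f := fun x : Fin n → ℝ => ∑ i, x i) (by fun_prop) continuous_const)

theorem KK_compact (n : ℕ) : IsCompact (KK n) := by
  refine (isCompact_Icc (a := (0 : Fin n → ℝ)) (b := 1)).of_isClosed_subset (KK_closed n) ?_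
  rintro x ⟨h1, h2⟩
  refine ⟨h1, fun i => ?_⟩
  exact (Finset.single_le_sum (f := x) (fun j _ => h1 j) (Finset.mem_univ i)).trans h2

theorem KK_convex (n : ℕ) : Convex ℝ (KK n) := by
  rintro x ⟨h1, h2⟩ y ⟨h3, h4⟩ a b ha hb hab
  refine ⟨add_nonneg (smul_nonneg ha h1) (smul_nonneg hb h3), ?_⟩
  simp only [Pi.add_apply, Pi.smul_apply, smul_eq_mul, Finset.sum_add_distrib, ← Finset.mul_sum]
  nlinarith

/-- Solves the VI on the truncated orthant. -/
def VI {n k : ℕ} (A : Fin n → (Fin k → Fin n) → ℝ) (b u : Fin n → ℝ) : Prop :=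
  u ∈ KK n ∧ ∀ v ∈ KK n, 0 ≤ (tApply A u + b) ⬝ᵥ (v - u)

theorem exists_bound {n k : ℕ} (A : Fin n → (Fin k → Fin n) → ℝ) (hA : IsR0 A)
    (hpos : ∀ x, 0 ≤ x → 0 ≤ tApply A x ⬝ᵥ x) :
    ∃ c > 0, ∀ b u, ‖b‖ < c → VI A b u → ∑ i, u i < 1 := by
  by_contra hcon
  push Not at hcon
  have h : ∀ N : ℕ, ∃ b u, ‖b‖ < 1 / ((N : ℝ) + 1) ∧ VI A b u ∧ 1 ≤ ∑ i, u i := fun N =>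
    hcon _ (by positivity)
  choose b u hb hV hs using h
  have hb0 : Filter.Tendsto b Filter.atTop (nhds 0) := by
    rw [tendsto_zero_iff_norm_tendsto_zero]
    exact squeeze_zero (fun _ => norm_nonneg _) (fun N => (hb N).le) tendsto_one_div_add_atTop_nhds_zero_nat
  obtain ⟨w, hw, φ, hφ, hlim⟩ := (KK_compact n).tendsto_subseq (fun N => (hV N).1)
  have hb1 := hb0.comp hφ.tendsto_atTop
  have hs1 : 1 ≤ ∑ i, w i := by
    have : Continuous (fun w : Fin n → ℝ => ∑ i, w i) := by fun_prop
    exact ge_of_tendsto' ((this.tendsto w).comp hlim) (fun N => hs _)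
  have hv1 : ∀ v ∈ KK n, 0 ≤ (tApply A w) ⬝ᵥ (v - w) := by
    intro v hv
    have hc : Continuous (fun p : (Fin n → ℝ) × (Fin n → ℝ) => (tApply A p.2 + p.1) ⬝ᵥ (v - p.2)) := by
      have := (tApply_continuous A)
      unfold dotProduct
      fun_prop
    have := ge_of_tendsto' ((hc.tendsto (0, w)).comp (hb1.prodMk_nhds hlim)) (fun N => (hV _).2 v hv)
    simpa using this
  have h0 : (0 : Fin n → ℝ) ∈ KK n := ⟨le_rfl, by simp⟩
  have hww : tApply A w ⬝ᵥ w = 0 := by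
    have h1 := hv1 0 h0
    rw [zero_sub, dotProduct_neg] at h1
    linarith [hpos w hw.1]
  have hsol : w ∈ Sol A 0 := by
    refine ⟨hw.1, fun i => ?_, ?_⟩
    · have := hv1 (Pi.single i 1) ⟨by simp [Pi.single_nonneg], by simp⟩
      rw [dotProduct_sub, hww] at this
      simpa using this
    · have : w ⬝ᵥ tApply A w = 0 := by rw [dotProduct_comm, hww]
      simpa [dotProduct] using this
  rw [hA] at hsol
  have : w = 0 := hsol
  subst this
  simp at hs1
  linarith

theorem VI_exists {n k : ℕ} (A : Fin n → (Fin k → Fin n) → ℝ) (b : Fin n → ℝ)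
    (hmono : ∀ x y, 0 ≤ x → 0 ≤ y → 0 ≤ (tApply A y - tApply A x) ⬝ᵥ (y - x)) :
    ∃ u, VI A b u := by
  obtain ⟨x, hx, h⟩ := minty_exists (KK n) (KK_compact n) (KK_convex n) ⟨0, le_rfl, by simp⟩
    (fun x => tApply A x + b) (by
      intro x hx y hy
      have := hmono x y hx.1 hy.1
      rwa [add_sub_add_right_eq_sub])
  exact ⟨x, hx, minty_imp (KK n) (KK_convex n) (fun x => tApply A x + b)
    ((tApply_continuous A).add continuous_const) x hx h⟩

theorem sol_of_VI {n k : ℕ} (A : Fin n → (Fin k → Fin n) → ℝ) (b u : Fin n → ℝ) (h : VI A b u)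
    (hs : ∑ i, u i < 1) : u ∈ Sol A b := by
  rw [sol_iff]
  refine ⟨h.1.1, fun y hy => ?_⟩
  set Y := ∑ i, y i
  have hY : 0 ≤ Y := Finset.sum_nonneg fun i _ => hy i
  set t := (1 - ∑ i, u i) / (1 + Y) with ht
  have hu0 : 0 ≤ ∑ i, u i := Finset.sum_nonneg fun i _ => h.1.1 i
  have ht0 : 0 < t := div_pos (by linarith) (by linarith)
  have htY : t * (1 + Y) = 1 - ∑ i, u i := div_mul_cancel₀ _ (by linarith)
  have ht1 : t ≤ 1 := by rw [ht, div_le_one (by linarith)]; linarith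
  have := h.2 (u + t • (y - u)) (by
    constructor
    · intro i
      have h1 := h.1.1 i
      have h2 := hy i
      simp only [Pi.zero_apply, Pi.add_apply, Pi.smul_apply, Pi.sub_apply, smul_eq_mul] at *
      nlinarith
    · simp only [Pi.add_apply, Pi.smul_apply, Pi.sub_apply, smul_eq_mul, Finset.sum_add_distrib,
        ← Finset.mul_sum, Finset.sum_sub_distrib]
      change _ + t * (Y - _) ≤ 1
      nlinarith)
  rw [add_sub_cancel_left, dotProduct_smul, smul_eq_mul] at this
  exact nonneg_of_mul_nonneg_right this ht0

theorem VI_of_sol {n k : ℕ} (A : Fin n → (Fin k → Fin n) → ℝ) (b u : Fin n → ℝ) (h : u ∈ Sol A b)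
    (hs : ∑ i, u i ≤ 1) : VI A b u := by
  rw [sol_iff] at h
  exact ⟨⟨h.1, hs⟩, fun v hv => h.2 v hv.1⟩

theorem sol_nonempty {n k : ℕ} (hk : 1 ≤ k) (A : Fin n → (Fin k → Fin n) → ℝ) (hA : IsR0 A)
    (hmono : ∀ x y, 0 ≤ x → 0 ≤ y → 0 ≤ (tApply A y - tApply A x) ⬝ᵥ (y - x))
    (hpos : ∀ x, 0 ≤ x → 0 ≤ tApply A x ⬝ᵥ x) (a : Fin n → ℝ) : (Sol A a).Nonempty := by
  obtain ⟨c, hc, hb⟩ := exists_bound A hA hpos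
  set r : ℝ := 1 + ‖a‖ / c with hr
  have hq : 0 ≤ ‖a‖ / c := by positivity
  have hr1 : 1 ≤ r := by linarith
  have hr0 : 0 < r := by linarith
  obtain ⟨u, hu⟩ := VI_exists A ((r ^ k)⁻¹ • a) hmono
  have hlt := hb _ _ (by
    rw [norm_smul, norm_inv, norm_pow, Real.norm_of_nonneg hr0.le, inv_mul_lt_iff₀ (by positivity)]
    have h1 : r ≤ r ^ k := le_self_pow₀ hr1 (by omega)
    have h2 : ‖a‖ < r * c := by
      rw [hr, add_mul, div_mul_cancel₀ _ hc.ne']; linarith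
    nlinarith) hu
  have := sol_smul A _ _ r hr0 (sol_of_VI A _ _ hu hlt)
  rw [smul_smul, mul_inv_cancel₀ (by positivity), one_smul] at this
  exact ⟨_, this⟩

theorem sol_bound {n k : ℕ} (hk : 1 ≤ k) (A : Fin n → (Fin k → Fin n) → ℝ) (hA : IsR0 A)
    (hpos : ∀ x, 0 ≤ x → 0 ≤ tApply A x ⬝ᵥ x) :
    ∃ c > 0, ∀ a x, x ∈ Sol A a → ∑ i, x i ≤ 1 + ‖a‖ / c := by
  obtain ⟨c, hc, hb⟩ := exists_bound A hA hpos
  refine ⟨c, hc, fun a x hx => ?_⟩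
  by_contra! hcon
  set r := ∑ i, x i with hr
  have hq : 0 ≤ ‖a‖ / c := by positivity
  have hr1 : 1 ≤ r := by linarith
  have hr0 : 0 < r := by linarith
  have hs := sol_smul A _ _ r⁻¹ (by positivity) hx
  have hsum : ∑ i, (r⁻¹ • x) i = 1 := by
    simp only [Pi.smul_apply, smul_eq_mul, ← Finset.mul_sum]
    exact inv_mul_cancel₀ hr0.ne'
  have := hb _ _ (by
    rw [norm_smul, norm_pow, norm_inv, Real.norm_of_nonneg hr0.le, inv_pow, inv_mul_lt_iff₀ (by positivity)]
    have h1 : r ≤ r ^ k := le_self_pow₀ hr1 (by omega)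
    have h2 : ‖a‖ < r * c := by
      rw [← div_lt_iff₀ hc]; linarith
    nlinarith) (VI_of_sol A _ _ hs hsum.le)
  linarith

theorem sol_graph_closed {n k : ℕ} (A : Fin n → (Fin k → Fin n) → ℝ) :
    IsClosed {p : (Fin n → ℝ) × (Fin n → ℝ) | p.2 ∈ Sol A p.1} := by
  have hc := tApply_continuous A
  have hci : ∀ i, Continuous (fun p : (Fin n → ℝ) × (Fin n → ℝ) => tApply A p.2 i) := fun i =>
    (continuous_apply i).comp (hc.comp continuous_snd)
  have h1 : IsClosed {p : (Fin n → ℝ) × (Fin n → ℝ) | ∀ i, 0 ≤ p.2 i} := by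
    simp only [Set.ofPred_forall]
    exact isClosed_iInter fun i => isClosed_le continuous_const (by fun_prop)
  have h2 : IsClosed {p : (Fin n → ℝ) × (Fin n → ℝ) | ∀ i, 0 ≤ tApply A p.2 i + p.1 i} := by
    simp only [Set.ofPred_forall]
    exact isClosed_iInter fun i => isClosed_le continuous_const ((hci i).add (by fun_prop))
  have h3 : IsClosed {p : (Fin n → ℝ) × (Fin n → ℝ) | ∑ i, p.2 i * (tApply A p.2 i + p.1 i) = 0} :=
    isClosed_eq (by fun_prop) continuous_const
  exact h1.inter (h2.inter h3)

theorem sol_convex {n k : ℕ} (A : Fin n → (Fin k → Fin n) → ℝ) (a : Fin n → ℝ)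
    (hmono : ∀ x y, 0 ≤ x → 0 ≤ y → 0 ≤ (tApply A y - tApply A x) ⬝ᵥ (y - x)) :
    Convex ℝ (Sol A a) := by
  have key : ∀ x, x ∈ Sol A a ↔ 0 ≤ x ∧ ∀ y, 0 ≤ y → 0 ≤ (tApply A y + a) ⬝ᵥ (y - x) := by
    intro x
    rw [sol_iff]
    constructor
    · rintro ⟨h1, h2⟩
      refine ⟨h1, fun y hy => ?_⟩
      have e1 := h2 y hy
      have e2 := hmono x y h1 hy
      rw [sub_dotProduct] at e2
      rw [add_dotProduct] at e1 ⊢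
      linarith
    · rintro ⟨h1, h2⟩
      exact ⟨h1, minty_imp (Set.Ici 0) (convex_Ici _) (fun x => tApply A x + a)
        ((tApply_continuous A).add continuous_const) x h1 h2⟩
  intro x hx y hy s t hs ht hst
  rw [key] at hx hy ⊢
  refine ⟨add_nonneg (smul_nonneg hs hx.1) (smul_nonneg ht hy.1), fun z hz => ?_⟩
  have e1 := hx.2 z hz
  have e2 := hy.2 z hz
  have : z - (s • x + t • y) = s • (z - x) + t • (z - y) := by
    have : z = (s + t) • z := by rw [hst, one_smul]
    nth_rewrite 1 [this]
    module
  rw [this, dotProduct_add, dotProduct_smul, dotProduct_smul]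
  exact add_nonneg (mul_nonneg hs e1) (mul_nonneg ht e2)

open Classical in
/-- The map whose critical values contain the bad right-hand sides with support `I`. -/
noncomputable def GG {n k : ℕ} (A : Fin n → (Fin k → Fin n) → ℝ) (I : Set (Fin n)) (z : Fin n → ℝ) :
    Fin n → ℝ :=
  fun i => if i ∈ I then - tApply A (fun j => if j ∈ I then z j else 0) i else z i

theorem GG_differentiable {n k : ℕ} (A : Fin n → (Fin k → Fin n) → ℝ) (I : Set (Fin n)) :
    Differentiable ℝ (GG A I) := by
  classical
  have hd := tApply_differentiable A
  have hp : Differentiable ℝ (fun z : Fin n → ℝ => (fun j => if j ∈ I then z j else 0 : Fin n → ℝ)) := by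
    rw [differentiable_pi]
    intro j
    by_cases h : j ∈ I
    · simp only [h, if_true]; fun_prop
    · simp only [h, if_false]; fun_prop
  have hc := hd.comp hp
  unfold GG
  rw [differentiable_pi]
  intro i
  by_cases h : i ∈ I
  · simp only [h, if_true]
    exact ((differentiable_pi.1 hc) i).neg
  · simp only [h, if_false]; fun_prop

/-- The bad set. -/
def Bad {n k : ℕ} (A : Fin n → (Fin k → Fin n) → ℝ) : Set (Fin n → ℝ) :=
  ⋃ I : Set (Fin n), GG A I '' {z | (fderiv ℝ (GG A I) z).det = 0}

theorem Bad_null {n k : ℕ} (A : Fin n → (Fin k → Fin n) → ℝ) : volume (Bad A) = 0 := by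
  unfold Bad
  rw [measure_iUnion_null_iff]
  intro I
  exact addHaar_image_eq_zero_of_det_fderivWithin_eq_zero volume
    (fun x _ => ((GG_differentiable A I) x).hasFDerivAt.hasFDerivWithinAt) (fun x hx => hx)

theorem sol_comp {n k : ℕ} (A : Fin n → (Fin k → Fin n) → ℝ) (a x : Fin n → ℝ) (h : x ∈ Sol A a)
    (i : Fin n) (hi : 0 < x i) : a i = - tApply A x i := by
  obtain ⟨h1, h2, h3⟩ := h
  rw [Finset.sum_eq_zero_iff_of_nonneg (fun i _ => mul_nonneg (h1 i) (h2 i))] at h3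
  have := h3 i (Finset.mem_univ i)
  rcases mul_eq_zero.1 this with h | h <;> linarith

theorem sol_unique {n k : ℕ} (A : Fin n → (Fin k → Fin n) → ℝ) (a : Fin n → ℝ)
    (hmono : ∀ x y, 0 ≤ x → 0 ≤ y → 0 ≤ (tApply A y - tApply A x) ⬝ᵥ (y - x))
    (ha : a ∉ Bad A) (x y : Fin n → ℝ) (hx : x ∈ Sol A a) (hy : y ∈ Sol A a) : x = y := by
  classical
  by_contra hne
  apply ha
  let I : Set (Fin n) := {i | 0 < x i ∨ 0 < y i}
  let z : ℝ → Fin n → ℝ := fun t i => if i ∈ I then x i + t * (y i - x i) else a i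
  have hoff : ∀ i, i ∉ I → x i = 0 ∧ y i = 0 := by
    intro i hi
    simp only [I, Set.mem_ofPred_eq, not_or, not_lt] at hi
    exact ⟨le_antisymm hi.1 (hx.1 i), le_antisymm hi.2 (hy.1 i)⟩
  have hG : ∀ t ∈ Set.Ioo (0:ℝ) 1, GG A I (z t) = a := by
    intro t ht
    have hsol := (sol_convex A a hmono).add_smul_sub_mem hx hy ⟨ht.1.le, ht.2.le⟩
    have hz : (fun j => if j ∈ I then z t j else 0) = x + t • (y - x) := by
      funext j
      by_cases hj : j ∈ I
      · simp [z, hj]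
      · simp [hj, hoff j hj]
    funext i
    by_cases hi : i ∈ I
    · have := sol_comp A a _ hsol i (by
        have h1 := hx.1 i
        have h2 := hy.1 i
        simp only [Pi.add_apply, Pi.smul_apply, Pi.sub_apply, smul_eq_mul]
        rcases hi with hi | hi <;> nlinarith [ht.1, ht.2, mul_pos ht.1 hi, mul_pos (sub_pos.2 ht.2) hi, mul_nonneg ht.1.le h1, mul_nonneg ht.1.le h2, mul_nonneg (sub_pos.2 ht.2).le h1])
      rw [this, ← hz]
      simp only [GG, hi, if_true]
      congr!
    · simp [GG, hi, z]
  have hh : (1/2 : ℝ) ∈ Set.Ioo (0:ℝ) 1 := by constructor <;> norm_num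
  refine Set.mem_iUnion.2 ⟨I, z (1/2), ?_, hG _ hh⟩
  have hz' : HasDerivAt z (y - x) (1/2) := by
    rw [hasDerivAt_pi]
    intro i
    by_cases hi : i ∈ I
    · simp only [z, hi, if_true]
      have := ((hasDerivAt_id (1/2 : ℝ)).mul_const (y i - x i)).const_add (x i)
      simpa using this
    · simp only [z, hi, if_false]
      have := hasDerivAt_const (1/2 : ℝ) (a i)
      simpa [hoff i hi] using this
  have h1 := ((GG_differentiable A I) (z (1/2))).hasFDerivAt.comp_hasDerivAt (1/2 : ℝ) hz'
  have h2 : HasDerivAt (GG A I ∘ z) 0 (1/2) := by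
    refine (hasDerivAt_const (1/2 : ℝ) a).congr_of_eventuallyEq ?_
    filter_upwards [Ioo_mem_nhds hh.1 hh.2] with t ht
    exact hG t ht
  have h3 := h1.unique h2
  change (fderiv ℝ (GG A I) (z (1/2))).det = 0
  by_contra hdet
  have hker : LinearMap.ker (fderiv ℝ (GG A I) (z (1/2))).toLinearMap = ⊥ := by
    by_contra hb
    exact hdet (LinearMap.det_eq_zero_iff_ker_ne_bot.2 hb)
  have : y - x ∈ LinearMap.ker (fderiv ℝ (GG A I) (z (1/2))).toLinearMap := h3
  rw [hker] at this
  exact hne (sub_eq_zero.1 this).symm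

/-- if `A` is R₀ and `F(x) = A x^(m-1)` is monotone on ℝⁿ₊, then on a dense
full-measure set `S` of right-hand sides the solution map is single-valued and continuous. -/
theorem stmt_16 (m n : ℕ) (hm : 2 ≤ m) (hn : 2 ≤ n) (A : Fin n → (Fin (m - 1) → Fin n) → ℝ) (hA : IsR0 A)
    (hmono : ∀ x y : Fin n → ℝ, (∀ i, 0 ≤ x i) → (∀ i, 0 ≤ y i) →
      0 ≤ ∑ i, (tApply A y i - tApply A x i) * (y i - x i)) :
    ∃ (S : Set (Fin n → ℝ)) (s : (Fin n → ℝ) → (Fin n → ℝ)),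
      Dense S ∧ MeasureTheory.volume Sᶜ = 0 ∧
      (∀ a ∈ S, Sol A a = {s a}) ∧ ContinuousOn s S := by
  have hk : 1 ≤ m - 1 := by omega
  have hmono' : ∀ x y, 0 ≤ x → 0 ≤ y → 0 ≤ (tApply A y - tApply A x) ⬝ᵥ (y - x) := fun x y hx hy =>
    hmono x y hx hy
  have h0 : tApply A 0 = 0 := by
    have := tApply_smul A 0 0
    rwa [smul_zero, zero_pow (by omega), zero_smul] at this
  have hpos : ∀ x, 0 ≤ x → 0 ≤ tApply A x ⬝ᵥ x := by
    intro x hx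
    have := hmono' 0 x le_rfl hx
    rwa [h0, sub_zero, sub_zero] at this
  have hne := sol_nonempty hk A hA hmono' hpos
  choose s hs using hne
  obtain ⟨c, hc, hbd⟩ := sol_bound hk A hA hpos
  refine ⟨(Bad A)ᶜ, s, ?_, ?_, ?_, ?_⟩
  · exact Measure.dense_of_ae (μ := volume) (p := fun x => x ∉ Bad A)
      (measure_eq_zero_iff_ae_notMem.1 (Bad_null A))
  · rw [compl_compl]; exact Bad_null A
  · intro a ha
    ext x
    exact ⟨fun hx => sol_unique A a hmono' ha x _ hx (hs a), fun hx => hx ▸ hs a⟩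
  · intro a ha
    set R := 1 + (‖a‖ + 1) / c
    refine (isCompact_Icc (a := (0 : Fin n → ℝ)) (b := fun _ => R)).tendsto_nhds_of_unique_mapClusterPt ?_ ?_
    · have : ∀ᶠ b in nhdsWithin a (Bad A)ᶜ, ‖b‖ < ‖a‖ + 1 :=
        nhdsWithin_le_nhds ((continuous_norm.tendsto a).eventually (gt_mem_nhds (by linarith)))
      filter_upwards [this] with b hb
      refine ⟨(hs b).1, fun i => ?_⟩
      refine (Finset.single_le_sum (f := s b) (fun j _ => (hs b).1 j) (Finset.mem_univ i)).trans ?_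
      refine (hbd b _ (hs b)).trans ?_
      simp only [R]
      gcongr
    · intro y _ hy
      rw [mapClusterPt_iff_ultrafilter] at hy
      obtain ⟨U, hU, hUy⟩ := hy
      have hUa : Filter.Tendsto id (U : Filter (Fin n → ℝ)) (nhds a) := hU.trans nhdsWithin_le_nhds
      have := (sol_graph_closed A).mem_of_tendsto (hUa.prodMk_nhds hUy)
        (Filter.Eventually.of_forall fun b => hs b)
      exact sol_unique A a hmono' ha _ _ this (hs a)
end
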